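/- arXiv:2103.06853 — 2 statements merged into one kernel-verified Lean document; each statement's English description precedes it below -/
import Mathlib

section
/- Let G be a finite connected simple graph and let n ≥ 1 be an integer such that at least n vertices of G have degree ≥ 3. Then G has a spanning tree with at least n/4 + 2 leaves, i.e. a connected acyclic spanning subgraph T of G having at least n/4 + 2 vertices of degree 1 in T. -/
namespace MaxLeaf
open Finset Classical

variable {V : Type*} [Fintype V] (G : SimpleGraph V)

noncomputable def cn (I : Finset V) : Finset V := univ.filter (fun v => v ∈ I ∨ ∃ a ∈ I, G.Adj a v)
noncomputable def bd (I : Finset V) : Finset V := cn G I \ I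
noncomputable def dead (I : Finset V) : Finset V :=
  (bd G I).filter (fun v => ∀ w, G.Adj v w → w ∈ cn G I)
noncomputable def out (I : Finset V) (v : V) : Finset V :=
  univ.filter (fun w => G.Adj v w ∧ w ∉ cn G I)
noncomputable def big : Finset V := univ.filter (fun v => 3 ≤ G.degree v)
noncomputable def phi (I : Finset V) : ℤ :=
  3 * ((bd G I).card : ℤ) + (dead G I).card - ((big G ∩ cn G I).card : ℤ)

def Conn (I : Finset V) : Prop :=
  I.Nonempty ∧ ∀ H : SimpleGraph V, (∀ a ∈ I, ∀ b ∈ I, G.Adj a b → H.Adj a b) →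
    ∀ a ∈ I, ∀ b ∈ I, H.Reachable a b

variable {G}

lemma mem_cn {I : Finset V} {v : V} : v ∈ cn G I ↔ v ∈ I ∨ ∃ a ∈ I, G.Adj a v := by simp [cn]
lemma mem_bd {I : Finset V} {v : V} : v ∈ bd G I ↔ (∃ a ∈ I, G.Adj a v) ∧ v ∉ I := by
  simp only [bd, mem_sdiff, mem_cn]; tauto
lemma mem_out {I : Finset V} {v w : V} : w ∈ out G I v ↔ G.Adj v w ∧ w ∉ cn G I := by simp [out]
lemma mem_dead {I : Finset V} {v : V} :
    v ∈ dead G I ↔ v ∈ bd G I ∧ ∀ w, G.Adj v w → w ∈ cn G I := by simp [dead]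

lemma conn_singleton (v : V) : Conn G {v} := by
  refine ⟨by simp, ?_⟩
  intro H _ a ha b hb
  simp at ha hb; subst ha; subst hb; exact SimpleGraph.Reachable.refl _

lemma conn_insert {I : Finset V} (hI : Conn G I) {x : V} (hx : ∃ a ∈ I, G.Adj a x) :
    Conn G (insert x I) := by
  refine ⟨by simp, ?_⟩
  intro H hH
  obtain ⟨c, hc, hcx⟩ := hx
  have h1 := hI.2 H (fun a ha b hb => hH a (by simp [ha]) b (by simp [hb]))
  have h2 : ∀ a ∈ insert x I, H.Reachable c a := by
    intro a ha
    rcases mem_insert.1 ha with rfl | ha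
    · exact (hH c (by simp [hc]) a (by simp) hcx).reachable
    · exact h1 c hc a ha
  intro a ha b hb
  exact (h2 a ha).symm.trans (h2 b hb)

lemma cn_insert {I : Finset V} {x : V} (hx : x ∈ bd G I) :
    cn G (insert x I) = cn G I ∪ out G I x := by
  ext v
  have := mem_bd.1 hx
  simp only [mem_union, mem_out, mem_cn, mem_insert]
  constructor
  · rintro ((rfl | h) | ⟨a, (rfl | ha), h⟩)
    · exact Or.inl (Or.inr this.1)
    · tauto
    · tauto
    · exact Or.inl (Or.inr ⟨a, ha, h⟩)
  · rintro ((h | ⟨a, ha, h⟩) | ⟨h, -⟩)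
    · tauto
    · exact Or.inr ⟨a, Or.inr ha, h⟩
    · exact Or.inr ⟨x, Or.inl rfl, h⟩

lemma disj_out (I : Finset V) (x : V) : Disjoint (cn G I) (out G I x) := by
  rw [Finset.disjoint_left]; intro a ha hb; exact (mem_out.1 hb).2 ha

lemma bd_sub (I : Finset V) : bd G I ⊆ cn G I := sdiff_subset
lemma sub_cn (I : Finset V) : I ⊆ cn G I := fun v hv => mem_cn.2 (Or.inl hv)
lemma dead_sub (I : Finset V) : dead G I ⊆ bd G I := filter_subset _ _

lemma bd_insert {I : Finset V} {x : V} (hx : x ∈ bd G I) :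
    bd G (insert x I) = (bd G I).erase x ∪ out G I x := by
  have h := cn_insert hx
  ext v
  have h1 : v ∈ out G I x → v ∉ I := fun hv hI => (mem_out.1 hv).2 (sub_cn I hI)
  have h2 : v ∈ out G I x → v ≠ x := fun hv e => (mem_out.1 hv).1.ne e.symm
  rw [bd, h]
  simp only [mem_sdiff, mem_union, mem_insert, mem_erase, bd]
  tauto

lemma card_bd_insert {I : Finset V} {x : V} (hx : x ∈ bd G I) :
    (bd G (insert x I)).card + 1 = (bd G I).card + (out G I x).card := by
  rw [bd_insert hx, card_union_of_disjoint]
  · have := card_erase_add_one hx; omega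
  · exact Disjoint.mono_left ((erase_subset _ _).trans (bd_sub I)) (disj_out I x)

lemma card_big_insert {I : Finset V} {x : V} (hx : x ∈ bd G I) :
    (big G ∩ cn G (insert x I)).card = (big G ∩ cn G I).card + (big G ∩ out G I x).card := by
  rw [cn_insert hx, inter_union_distrib_left, card_union_of_disjoint]
  exact Disjoint.mono inter_subset_right inter_subset_right (disj_out I x)

lemma dead_insert {I : Finset V} {x : V} (hx : x ∈ bd G I) (ho : (out G I x).Nonempty) :
    dead G I ⊆ dead G (insert x I) := by
  intro v hv
  obtain ⟨h1, h2⟩ := mem_dead.1 hv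
  rw [mem_dead, bd_insert hx, cn_insert hx]
  have : v ≠ x := by
    rintro rfl
    obtain ⟨w, hw⟩ := ho
    exact (mem_out.1 hw).2 (h2 w (mem_out.1 hw).1)
  refine ⟨by simp [this, h1], fun w hw => mem_union_left _ (h2 w hw)⟩

lemma dead_eq {I : Finset V} (h : cn G I = univ) : dead G I = bd G I := by
  ext v; rw [mem_dead, h]; simp

lemma card_dead_final {I : Finset V} {x : V} (hx : x ∈ bd G I) (ho : (out G I x).Nonempty)
    (h : cn G (insert x I) = univ) :
    (dead G I).card + (out G I x).card ≤ (dead G (insert x I)).card := by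
  rw [← card_union_of_disjoint]
  · apply card_le_card
    apply union_subset (dead_insert hx ho)
    rw [dead_eq h, bd_insert hx]; exact subset_union_right
  · exact Disjoint.mono_left ((dead_sub I).trans (bd_sub I)) (disj_out I x)

lemma step (hG : G.Connected) {I : Finset V} (hI : Conn G I) (hne : cn G I ≠ univ) (c : ℕ)
    (hc : c ≤ 2) (hdeg : ∀ v, c ≤ G.degree v) :
    ∃ J, I ⊂ J ∧ Conn G J ∧ phi G I ≤ phi G J ∧ (cn G J = univ → phi G I + c ≤ phi G J) := by
  -- some boundary vertex has an outside neighbour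
  have hex : ∃ x ∈ bd G I, (out G I x).Nonempty := by
    by_contra! hcon
    apply hne
    obtain ⟨a, ha⟩ := hI.1
    have key : ∀ u v, G.Walk u v → u ∈ cn G I → v ∈ cn G I := by
      intro u v p
      induction p with
      | nil => exact id
      | @cons u v w h p ih =>
        intro hu
        apply ih
        by_contra hv
        have huI : u ∉ I := fun hu' => hv (mem_cn.2 (Or.inr ⟨u, hu', h⟩))
        have := hcon u (by rw [bd, mem_sdiff]; exact ⟨hu, huI⟩)
        have h3 : v ∈ out G I u := mem_out.2 ⟨h, hv⟩
        simp [this] at h3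
    ext v
    obtain ⟨p⟩ := hG.preconnected a v
    simp [key a v p (sub_cn I ha)]
  by_cases h1 : ∃ x ∈ bd G I, 2 ≤ (out G I x).card
  · obtain ⟨x, hx, hk⟩ := h1
    have ho : (out G I x).Nonempty := card_pos.1 (by omega)
    have e1 := card_bd_insert hx
    have e2 := card_big_insert hx
    have e3 := card_le_card (dead_insert hx ho)
    have e4 := card_dead_final hx ho
    have e5 : (big G ∩ out G I x).card ≤ (out G I x).card := card_le_card inter_subset_right
    refine ⟨insert x I, ssubset_insert (mem_bd.1 hx).2, conn_insert hI (mem_bd.1 hx).1, ?_, ?_⟩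
    · unfold phi; omega
    · intro hf
      have := e4 hf
      unfold phi; omega
  · push Not at h1
    obtain ⟨x, hx, ho⟩ := hex
    have hk : (out G I x).card = 1 := by have := h1 x hx; have := card_pos.2 ho; omega
    obtain ⟨y, hy⟩ := card_eq_one.1 hk
    have hyo : y ∈ out G I x := by simp [hy]
    obtain ⟨hxy, hyS⟩ := mem_out.1 hyo
    have hyb : y ∈ bd G (insert x I) := by rw [bd_insert hx]; simp [hyo]
    have hout : out G (insert x I) y = out G I y := by
      ext w
      rw [mem_out, mem_out, cn_insert hx, hy]
      simp only [mem_union, mem_singleton]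
      have : G.Adj y w → w ≠ y := fun h => h.ne.symm
      tauto
    have hcI := conn_insert hI (mem_bd.1 hx).1
    have e1 := card_bd_insert hx
    have e2 := card_big_insert hx
    have e3 := card_le_card (dead_insert hx ho)
    have e5 : (big G ∩ out G I x).card ≤ (out G I x).card := card_le_card inter_subset_right
    by_cases hk2 : 2 ≤ (out G I y).card
    · have ho' : (out G (insert x I) y).Nonempty := card_pos.1 (by rw [hout]; omega)
      have f1 := card_bd_insert hyb
      have f2 := card_big_insert hyb
      have f3 := card_le_card (dead_insert hyb ho')
      have f4 := card_dead_final hyb ho'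
      have f5 : (big G ∩ out G (insert x I) y).card ≤ (out G (insert x I) y).card :=
        card_le_card inter_subset_right
      rw [hout] at f1 f2 f4 f5
      refine ⟨insert y (insert x I),
        (ssubset_insert (mem_bd.1 hx).2).trans (ssubset_insert (mem_bd.1 hyb).2),
        conn_insert hcI (mem_bd.1 hyb).1, ?_, ?_⟩
      · unfold phi; omega
      · intro hf
        have := f4 hf
        unfold phi; omega
    · -- newly dead vertices
      set A := (G.neighborFinset y ∩ cn G I).erase x with hA
      have hxA : x ∈ G.neighborFinset y ∩ cn G I := by
        simp [hxy.symm, bd_sub I hx]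
      have cA : A.card + 1 + (out G I y).card = G.degree y := by
        have g1 : A.card + 1 = (G.neighborFinset y ∩ cn G I).card := card_erase_add_one hxA
        have g2 : out G I y = G.neighborFinset y \ cn G I := by
          ext w; simp [mem_out]
        rw [g1, g2, ← G.card_neighborFinset_eq_degree, add_comm]
        exact card_sdiff_add_card_inter _ _
      have hAd : ∀ z ∈ A, z ∈ bd G I ∧ out G I z = {y} := by
        intro z hz
        simp only [hA, mem_erase, mem_inter, SimpleGraph.mem_neighborFinset] at hz
        obtain ⟨hzx, hyz, hzS⟩ := hz
        have hzb : z ∈ bd G I := by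
          rw [bd, mem_sdiff]
          exact ⟨hzS, fun hzI => hyS (mem_cn.2 (Or.inr ⟨z, hzI, hyz.symm⟩))⟩
        refine ⟨hzb, ?_⟩
        have hyz' : y ∈ out G I z := mem_out.2 ⟨hyz.symm, hyS⟩
        have := h1 z hzb
        have h3 : (out G I z).card ≤ 1 := by omega
        haveI : Nonempty V := ⟨x⟩
        exact (card_le_one_iff_subset_singleton.1 h3).elim fun t ht => by
          have := mem_singleton.1 (ht hyz')
          subst this
          exact Subset.antisymm ht (by simpa using hyz')
      have hA1 : A ⊆ dead G (insert x I) := by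
        intro z hz
        obtain ⟨hzb, hzo⟩ := hAd z hz
        have hzx : z ≠ x := by rw [hA] at hz; exact (mem_erase.1 hz).1
        rw [mem_dead, bd_insert hx, cn_insert hx, hy]
        refine ⟨by simp [hzx, hzb], fun w hw => ?_⟩
        by_cases hws : w ∈ cn G I
        · simp [hws]
        · have : w ∈ out G I z := mem_out.2 ⟨hw, hws⟩
          rw [hzo] at this
          simp only [mem_union, this, or_true]
      have hA2 : Disjoint (dead G I) A := by
        rw [Finset.disjoint_left]
        intro z hz hzA
        have h5 : y ∈ out G I z := by rw [(hAd z hzA).2]; simp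
        exact (mem_out.1 h5).2 ((mem_dead.1 hz).2 y (mem_out.1 h5).1)
      have g3 : (dead G I).card + A.card ≤ (dead G (insert x I)).card := by
        rw [← card_union_of_disjoint hA2]
        exact card_le_card (union_subset (dead_insert hx ho) hA1)
      have g4 : cn G (insert x I) = univ →
          (dead G I).card + A.card + 1 ≤ (dead G (insert x I)).card := by
        intro hf
        rw [← card_union_of_disjoint hA2]
        have : y ∉ dead G I ∪ A := by
          intro h
          rcases mem_union.1 h with h | h
          · exact hyS (bd_sub I (dead_sub I h))
          · exact hyS (bd_sub I (hAd y h).1)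
        rw [← card_insert_of_notMem this]
        apply card_le_card
        apply insert_subset
        · rw [dead_eq hf]; exact hyb
        · exact union_subset (dead_insert hx ho) hA1
      have g5 : cn G (insert x I) = univ → (out G I y).card = 0 := by
        intro hf
        rw [← hout, card_eq_zero, eq_empty_iff_forall_notMem]
        intro w hw
        have := (mem_out.1 hw).2
        rw [hf] at this; simp at this
      have g6 : 3 ≤ G.degree y ∨ (big G ∩ out G I x).card = 0 := by
        by_cases h : 3 ≤ G.degree y
        · exact Or.inl h
        · right
          rw [card_eq_zero, eq_empty_iff_forall_notMem]
          intro w hw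
          rw [hy] at hw
          simp only [big, mem_inter, mem_filter, mem_univ, true_and, mem_singleton] at hw
          obtain ⟨h1, rfl⟩ := hw
          exact h h1
      have hdy := hdeg y
      refine ⟨insert x I, ssubset_insert (mem_bd.1 hx).2, hcI, ?_, ?_⟩
      · unfold phi; omega
      · intro hf
        have := g4 hf
        have := g5 hf
        unfold phi; omega

lemma finish (hG : G.Connected) (c : ℕ) (hc : c ≤ 2) (hdeg : ∀ v, c ≤ G.degree v) :
    ∀ m : ℕ, ∀ I : Finset V, Iᶜ.card ≤ m → Conn G I → cn G I ≠ univ →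
    ∃ J, Conn G J ∧ cn G J = univ ∧ phi G I + c ≤ phi G J := by
  intro m
  induction m with
  | zero =>
    intro I hm _ hne
    exfalso; apply hne
    have : I = univ := by simpa using hm
    rw [← univ_subset_iff, ← this]; exact sub_cn I
  | succ m ih =>
    intro I hm hI hne
    obtain ⟨J, hIJ, hJ, h1, h2⟩ := step hG hI hne c hc hdeg
    by_cases hf : cn G J = univ
    · exact ⟨J, hJ, hf, h2 hf⟩
    · have : Jᶜ.card < Iᶜ.card := card_lt_card (by simpa using hIJ)
      obtain ⟨K, hK, hK2, h3⟩ := ih J (by omega) hJ hf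
      exact ⟨K, hK, hK2, by omega⟩

lemma phi_final {I : Finset V} (h : cn G I = univ) :
    phi G I = 4 * ((bd G I).card : ℤ) - (big G).card := by
  unfold phi; rw [dead_eq h, h, inter_univ]; ring

lemma bd_singleton (v : V) : bd G {v} = G.neighborFinset v := by
  ext w; simp only [mem_bd, mem_singleton, exists_eq_left, SimpleGraph.mem_neighborFinset]
  exact ⟨fun h => h.1, fun h => ⟨h, h.ne.symm⟩⟩

lemma cn_singleton (v : V) : cn G {v} = insert v (G.neighborFinset v) := by
  ext w; simp [mem_cn]

lemma card_cn_singleton (v : V) : (cn G {v}).card = G.degree v + 1 := by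
  rw [cn_singleton, card_insert_of_notMem (by simp), G.card_neighborFinset_eq_degree]

lemma phi_singleton (v : V) : 2 * (G.degree v : ℤ) - 1 ≤ phi G {v} ∧
    (cn G {v} = univ → 3 * (G.degree v : ℤ) - 1 ≤ phi G {v}) := by
  have h1 := card_cn_singleton (G := G) v
  have h2 : (big G ∩ cn G {v}).card ≤ (cn G {v}).card := card_le_card inter_subset_right
  have h3 : (bd G {v}).card = G.degree v := by
    rw [bd_singleton, G.card_neighborFinset_eq_degree]
  refine ⟨by unfold phi; omega, fun hf => ?_⟩
  have := dead_eq hf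
  unfold phi; rw [this]; omega

lemma closed_all (hG : G.Connected) {S : Finset V} {a : V} (ha : a ∈ S)
    (hS : ∀ b ∈ S, ∀ c, G.Adj b c → c ∈ S) (v : V) : v ∈ S := by
  obtain ⟨p⟩ := hG.preconnected a v
  induction p with
  | nil => exact ha
  | cons h p ih => exact ih (hS _ ha _ h)

lemma start_of {J : Finset V} (h1 : 3 ≤ (bd G J).card) {p : V} (hp : p ∈ dead G J)
    (h2 : (big G ∩ cn G J).card ≤ 3) :
    7 ≤ phi G J ∧ (cn G J = univ → 8 ≤ phi G J) := by
  have h3 := card_pos.2 ⟨p, hp⟩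
  refine ⟨by unfold phi; omega, fun hf => ?_⟩
  have := dead_eq hf
  unfold phi; rw [this]; omega

lemma pendant_nbr {p q : V} (hpd : G.degree p = 1) (hq : G.Adj p q) :
    ∀ b, G.Adj p b → b = q := by
  intro b hb
  rw [← G.card_neighborFinset_eq_degree] at hpd
  exact card_le_one.1 hpd.le b (by simpa using hb) q (by simpa using hq)

/-- pendant start, end of the chain -/
lemma chain_end {I : Finset V} {p w u : V} (hp : p ∉ I) (hp1 : ∃ a ∈ I, G.Adj a p)
    (hpd : G.degree p = 1) (hw : w ∈ I) (hu : u ∉ I) (hup : u ≠ p) (hwu : G.Adj w u)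
    (hI2 : ∀ a ∈ I, G.degree a ≤ 2)
    (hN : ∀ a ∈ I, ∀ b, G.Adj a b → b ∈ I ∨ b = p ∨ (a = w ∧ b = u))
    (hud : G.degree u = 3) : 7 ≤ phi G (insert u I) ∧
      (cn G (insert u I) = univ → 8 ≤ phi G (insert u I)) := by
  obtain ⟨q, hq, hqp⟩ := hp1
  have hpn := pendant_nbr hpd hqp.symm
  have hup' : ¬ G.Adj u p := fun h => hu (hpn u h.symm ▸ hq)
  have hwN : w ∈ G.neighborFinset u := by simpa using hwu.symm
  have c1 : ((G.neighborFinset u).erase w).card = 2 := by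
    rw [card_erase_of_mem hwN, G.card_neighborFinset_eq_degree, hud]
  have hpb : p ∈ bd G (insert u I) := by
    rw [mem_bd]; refine ⟨⟨q, by simp [hq], hqp⟩, ?_⟩
    simp [hp, hup.symm]
  refine start_of (p := p) ?_ ?_ ?_
  · have c2 : (insert p ((G.neighborFinset u).erase w)).card = 3 := by
      rw [card_insert_of_notMem (by simp [hup']), c1]
    rw [← c2]
    apply card_le_card
    apply insert_subset hpb
    intro b hb
    simp only [mem_erase, SimpleGraph.mem_neighborFinset] at hb
    rw [mem_bd]
    refine ⟨⟨u, by simp, hb.2⟩, ?_⟩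
    rw [mem_insert, not_or]
    refine ⟨hb.2.ne.symm, fun hbI => ?_⟩
    rcases hN b hbI u hb.2.symm with h | h | h
    · exact hu h
    · exact hup h
    · exact hb.1 h.1
  · rw [mem_dead]
    refine ⟨hpb, fun b hb => ?_⟩
    rw [hpn b hb]
    exact sub_cn _ (by simp [hq])
  · have c2 : (insert u ((G.neighborFinset u).erase w)).card = 3 := by
      rw [card_insert_of_notMem (by simp), c1]
    rw [← c2]
    apply card_le_card
    intro b hb
    simp only [big, mem_inter, mem_filter, mem_univ, true_and, mem_cn, mem_insert] at hb
    obtain ⟨hb3, hb⟩ := hb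
    have hbI : b ∉ I := fun h => by have := hI2 b h; omega
    have hbw : b ≠ w := fun h => hbI (h ▸ hw)
    have hbp : b ≠ p := fun h => by rw [h] at hb3; omega
    simp only [mem_insert, mem_erase, SimpleGraph.mem_neighborFinset]
    rcases hb with (rfl | hb) | ⟨a, (rfl | ha), hab⟩
    · exact Or.inl rfl
    · exact absurd hb hbI
    · exact Or.inr ⟨hbw, hab⟩
    · rcases hN a ha b hab with h | h | h
      · exact absurd h hbI
      · exact absurd h hbp
      · exact Or.inl h.2

lemma chain (hG : G.Connected) (h3 : ∃ v, 3 ≤ G.degree v) (hmax : ∀ v, G.degree v ≤ 3) {p : V}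
    (hpd : G.degree p = 1) :
    ∀ m : ℕ, ∀ I : Finset V, ∀ w u, Iᶜ.card ≤ m → Conn G I → p ∉ I → (∃ a ∈ I, G.Adj a p) →
    w ∈ I → u ∉ I → u ≠ p → G.Adj w u → (∀ a ∈ I, G.degree a ≤ 2) →
    (∀ a ∈ I, ∀ b, G.Adj a b → b ∈ I ∨ b = p ∨ (a = w ∧ b = u)) →
    ∃ J, Conn G J ∧ 7 ≤ phi G J ∧ (cn G J = univ → 8 ≤ phi G J) := by
  intro m
  induction m with
  | zero =>
    intro I w u hm _ hp
    have : I = univ := by simpa using hm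
    simp [this] at hp
  | succ m ih =>
    intro I w u hm hI hp hp1 hw hu hup hwu hI2 hN
    have hcI : Conn G (insert u I) := conn_insert hI ⟨w, hw, hwu⟩
    by_cases hud : G.degree u = 3
    · exact ⟨_, hcI, chain_end hp hp1 hpd hw hu hup hwu hI2 hN hud⟩
    have hud2 : G.degree u ≤ 2 := by have := hmax u; omega
    obtain ⟨q, hq, hqp⟩ := id hp1
    have hpn := pendant_nbr hpd hqp.symm
    have hup' : ¬ G.Adj u p := fun h => hu (hpn u h.symm ▸ hq)
    by_cases hex : ∃ u', G.Adj u u' ∧ u' ≠ w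
    · obtain ⟨u', huu', hu'w⟩ := hex
      have hall : ∀ b, G.Adj u b → b = w ∨ b = u' := by
        intro b hb
        by_contra! hcon
        have : ({b, w, u'} : Finset V).card ≤ G.degree u := by
          rw [← G.card_neighborFinset_eq_degree]
          apply card_le_card
          intro c hc
          simp only [mem_insert, mem_singleton] at hc
          rcases hc with rfl | rfl | rfl <;> simp [*, hwu.symm]
        rw [card_eq_three.2 ⟨b, w, u', hcon.1, hcon.2, hu'w.symm, rfl⟩] at this
        omega
      have hu'I : u' ∉ I := by
        intro h
        rcases hN u' h u huu'.symm with h | h | h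
        · exact hu h
        · exact hup h
        · exact hu'w h.1
      have hu'p : u' ≠ p := fun h => hup' (h ▸ huu')
      apply ih (insert u I) u u'
      · have : (insert u I)ᶜ.card < Iᶜ.card :=
          card_lt_card (compl_lt_compl_iff_lt.2 (ssubset_insert hu))
        omega
      · exact hcI
      · simp [hp, hup.symm]
      · exact ⟨q, by simp [hq], hqp⟩
      · simp
      · simp [hu'I, huu'.ne.symm]
      · exact hu'p
      · exact huu'
      · intro a ha
        rcases mem_insert.1 ha with rfl | ha
        · exact hud2
        · exact hI2 a ha
      · intro a ha b hab
        rcases mem_insert.1 ha with rfl | ha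
        · rcases hall b hab with rfl | rfl
          · left; simp [hw]
          · right; right; exact ⟨rfl, rfl⟩
        · rcases hN a ha b hab with h | h | h
          · left; simp [h]
          · right; left; exact h
          · left; simp [h.2]
    · push Not at hex
      exfalso
      obtain ⟨v, hv⟩ := h3
      have := closed_all hG (S := insert p (insert u I)) (a := p) (by simp) (by
        intro b hb c hbc
        simp only [mem_insert] at hb ⊢
        rcases hb with rfl | rfl | hb
        · rw [hpn c hbc]; simp [hq]
        · rw [hex c hbc]; simp [hw]
        · rcases hN b hb c hbc with h | h | h
          · simp [h]
          · simp [h]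
          · simp [h.2]) v
      simp only [mem_insert] at this
      rcases this with rfl | rfl | h
      · omega
      · omega
      · have := hI2 v h; omega

lemma pendant_start (hG : G.Connected) (h3 : ∃ v, 3 ≤ G.degree v) (hmax : ∀ v, G.degree v ≤ 3)
    {p : V} (hpd : G.degree p = 1) :
    ∃ J, Conn G J ∧ 7 ≤ phi G J ∧ (cn G J = univ → 8 ≤ phi G J) := by
  obtain ⟨q, hq⟩ : ∃ q, G.Adj p q := by
    have : 0 < (G.neighborFinset p).card := by rw [G.card_neighborFinset_eq_degree]; omega
    obtain ⟨q, hq⟩ := card_pos.1 this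
    exact ⟨q, by simpa using hq⟩
  have hpn := pendant_nbr hpd hq
  by_cases hqd : G.degree q = 3
  · refine ⟨{q}, conn_singleton q, start_of (p := p) ?_ ?_ ?_⟩
    · rw [bd_singleton, G.card_neighborFinset_eq_degree, hqd]
    · rw [mem_dead, bd_singleton]
      refine ⟨by simpa using hq.symm, fun b hb => ?_⟩
      rw [hpn b hb]; exact sub_cn _ (by simp)
    · have : big G ∩ cn G {q} ⊆ (cn G {q}).erase p := by
        intro b hb
        rw [mem_inter] at hb
        rw [mem_erase]
        refine ⟨?_, hb.2⟩
        rintro rfl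
        have := hb.1
        simp only [big, mem_filter] at this
        omega
      have h2 := card_le_card this
      have hpc : p ∈ cn G {q} := by rw [cn_singleton]; simp [hq.symm]
      rw [card_erase_of_mem hpc, card_cn_singleton, hqd] at h2
      exact h2
  · have hqd2 : G.degree q ≤ 2 := by have := hmax q; omega
    by_cases hex : ∃ u, G.Adj q u ∧ u ≠ p
    · obtain ⟨u, hqu, hup⟩ := hex
      refine chain hG h3 hmax hpd _ {q} q u le_rfl (conn_singleton q) (by simpa using hq.ne)
        ⟨q, by simp, hq.symm⟩ (by simp) (by simpa using hqu.ne.symm) hup hqu (by simpa using hqd2) ?_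
      intro a ha b hab
      rw [mem_singleton] at ha
      subst ha
      by_contra! hcon
      have : ({b, p, u} : Finset V).card ≤ G.degree a := by
        rw [← G.card_neighborFinset_eq_degree]
        apply card_le_card
        intro c hc
        simp only [mem_insert, mem_singleton] at hc
        rcases hc with rfl | rfl | rfl <;> simp [hab, hqu, hq.symm]
      rw [card_eq_three.2 ⟨b, p, u, hcon.2.1, hcon.2.2 rfl, hup.symm, rfl⟩] at this
      omega
    · push Not at hex
      exfalso
      obtain ⟨v, hv⟩ := h3
      have := closed_all hG (S := {p, q}) (a := p) (by simp) (by
        intro b hb c hbc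
        simp only [mem_insert, mem_singleton] at hb ⊢
        rcases hb with rfl | rfl
        · right; exact hpn c hbc
        · left; exact hex c hbc) v
      simp only [mem_insert, mem_singleton] at this
      rcases this with rfl | rfl <;> omega

lemma exists_good (hG : G.Connected) (h3 : ∃ v, 3 ≤ G.degree v) :
    ∃ J, Conn G J ∧ cn G J = univ ∧ 8 ≤ phi G J := by
  obtain ⟨v, hv⟩ := h3
  have hnt : Nontrivial V := by
    have : 0 < (G.neighborFinset v).card := by rw [G.card_neighborFinset_eq_degree]; omega
    obtain ⟨q, hq⟩ := card_pos.1 this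
    rw [SimpleGraph.mem_neighborFinset] at hq
    exact ⟨v, q, hq.ne⟩
  have hpos : ∀ v, 1 ≤ G.degree v := fun v => hG.preconnected.degree_pos_of_nontrivial v
  have key : ∀ J, Conn G J → 7 ≤ phi G J → (cn G J = univ → 8 ≤ phi G J) →
      ∃ J, Conn G J ∧ cn G J = univ ∧ 8 ≤ phi G J := by
    intro J hJ h7 h8
    by_cases hf : cn G J = univ
    · exact ⟨J, hJ, hf, h8 hf⟩
    · obtain ⟨K, hK, hK2, h⟩ := finish hG 1 (by norm_num) hpos _ J le_rfl hJ hf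
      exact ⟨K, hK, hK2, by push_cast at h; omega⟩
  by_cases h4 : ∃ v, 4 ≤ G.degree v
  · obtain ⟨v, hv⟩ := h4
    have h := phi_singleton (G := G) v
    exact key {v} (conn_singleton v) (by omega) (fun hf => by have := h.2 hf; omega)
  have hmax : ∀ v, G.degree v ≤ 3 := by
    intro v; by_contra hcon; exact h4 ⟨v, by omega⟩
  by_cases hp : ∃ p, G.degree p = 1
  · obtain ⟨p, hp⟩ := hp
    obtain ⟨J, hJ, h7, h8⟩ := pendant_start hG ⟨v, hv⟩ hmax hp
    exact key J hJ h7 h8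
  have h2 : ∀ v, 2 ≤ G.degree v := by
    intro v
    have := hpos v
    by_contra hcon
    exact hp ⟨v, by omega⟩
  have h := phi_singleton (G := G) v
  by_cases hf : cn G {v} = univ
  · exact ⟨{v}, conn_singleton v, hf, by have := h.2 hf; omega⟩
  · obtain ⟨K, hK, hK2, hk⟩ := finish hG 2 le_rfl h2 _ {v} le_rfl (conn_singleton v) hf
    refine ⟨K, hK, hK2, ?_⟩
    have hev := G.even_card_odd_degree_vertices
    have hb : (univ.filter fun v => Odd (G.degree v)) = big G := by
      ext w
      simp only [big, mem_filter, mem_univ, true_and]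
      have h1 := h2 w
      have h5 := hmax w
      constructor
      · rintro ⟨k, hk⟩; omega
      · intro h; exact ⟨1, by omega⟩
    rw [hb] at hev
    obtain ⟨r, hr⟩ := hev
    have := phi_final hK2
    push_cast at hk
    omega

lemma tree_of [Nontrivial V] {J : Finset V} (hJ : Conn G J) (hf : cn G J = univ) :
    ∃ T : SimpleGraph V, T ≤ G ∧ T.IsTree ∧ ∀ v ∈ bd G J, T.degree v = 1 := by
  have hpar : ∀ v, ∃ a, v ∉ J → a ∈ J ∧ G.Adj a v := by
    intro v
    by_cases hv : v ∈ J
    · exact ⟨v, fun h => absurd hv h⟩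
    · have : v ∈ cn G J := by rw [hf]; simp
      rcases mem_cn.1 this with h | ⟨a, h⟩
      · exact absurd h hv
      · exact ⟨a, fun _ => h⟩
  choose f hfp using hpar
  let H : SimpleGraph V :=
    { Adj := fun a b => G.Adj a b ∧ ((a ∈ J ∧ b ∈ J) ∨ (a ∉ J ∧ b = f a) ∨ (b ∉ J ∧ a = f b))
      symm := ⟨fun a b h => ⟨h.1.symm, by tauto⟩⟩
      loopless := ⟨fun a h => h.1.ne rfl⟩ }
  have hHG : H ≤ G := fun a b h => h.1
  obtain ⟨r, hr⟩ := hJ.1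
  have hin := hJ.2 H (fun a ha b hb hab => ⟨hab, Or.inl ⟨ha, hb⟩⟩)
  have hreach : ∀ v, H.Reachable r v := by
    intro v
    by_cases hv : v ∈ J
    · exact hin r hr v hv
    · have h1 := hfp v hv
      have : H.Adj (f v) v := ⟨h1.2, Or.inr (Or.inr ⟨hv, rfl⟩)⟩
      exact (hin r hr _ h1.1).trans this.reachable
  have hHc : H.Connected := by
    haveI : Nonempty V := ⟨r⟩
    exact ⟨fun a b => (hreach a).symm.trans (hreach b)⟩
  obtain ⟨T, hTH, hT⟩ := hHc.exists_isTree_le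
  refine ⟨T, hTH.trans hHG, hT, ?_⟩
  intro v hv
  have hvJ := (mem_bd.1 hv).2
  have h1 : 0 < T.degree v := hT.connected.preconnected.degree_pos_of_nontrivial v
  have h2 : T.degree v ≤ 1 := by
    rw [← T.card_neighborFinset_eq_degree]
    have : T.neighborFinset v ⊆ {f v} := by
      intro b hb
      rw [SimpleGraph.mem_neighborFinset] at hb
      have hb' := (hTH hb).2
      rw [mem_singleton]
      rcases hb' with h | h | h
      · exact absurd h.1 hvJ
      · exact h.2
      · exact absurd (h.2 ▸ (hfp b h.1).1) hvJ
    simpa using card_le_card this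
  omega

lemma ncard_nbr (H : SimpleGraph V) (v : V) : (H.neighborSet v).ncard = H.degree v := by
  rw [← H.card_neighborFinset_eq_degree, Set.ncard_eq_toFinset_card']
  rfl

end MaxLeaf

theorem cor_maxleaf (V : Type*) [Fintype V] (G : SimpleGraph V) (n : ℕ)
    (hG : G.Connected) (hn : 1 ≤ n)
    (hdeg : n ≤ {v : V | 3 ≤ (G.neighborSet v).ncard}.ncard) :
    ∃ T : SimpleGraph V, T ≤ G ∧ T.IsTree ∧
      (n : ℝ) / 4 + 2 ≤ ({v : V | (T.neighborSet v).ncard = 1}.ncard : ℝ) := by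
  classical
  have hbig : {v : V | 3 ≤ (G.neighborSet v).ncard} = (MaxLeaf.big G : Set V) := by
    ext v
    simp only [MaxLeaf.big, MaxLeaf.ncard_nbr, Set.mem_setOf_eq, Finset.coe_filter, Finset.mem_univ, true_and]
  rw [hbig, Set.ncard_coe_finset] at hdeg
  have h3 : ∃ v, 3 ≤ (G.neighborSet v).ncard := by
    obtain ⟨v, hv⟩ := Finset.card_pos.1 (lt_of_lt_of_le hn hdeg)
    have : v ∈ (MaxLeaf.big G : Set V) := hv
    rw [← hbig] at this
    exact ⟨v, this⟩
  simp only [MaxLeaf.ncard_nbr] at h3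
  obtain ⟨J, hJ, hf, h8⟩ := MaxLeaf.exists_good hG h3
  rw [MaxLeaf.phi_final hf] at h8
  have hnt : Nontrivial V := by
    have : 0 < (MaxLeaf.bd G J).card := by omega
    obtain ⟨x, hx⟩ := Finset.card_pos.1 this
    obtain ⟨⟨a, _, ha⟩, _⟩ := MaxLeaf.mem_bd.1 hx
    exact ⟨a, x, ha.ne⟩
  obtain ⟨T, hTG, hT, hl⟩ := MaxLeaf.tree_of hJ hf
  refine ⟨T, hTG, hT, ?_⟩
  have hle : (MaxLeaf.bd G J).card ≤ {v : V | (T.neighborSet v).ncard = 1}.ncard := by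
    rw [← Set.ncard_coe_finset]
    apply Set.ncard_le_ncard _ (Set.toFinite _)
    intro v hv
    simp only [MaxLeaf.ncard_nbr, Set.mem_setOf_eq]
    exact hl v hv
  have h9 : n + 8 ≤ 4 * {v : V | (T.neighborSet v).ncard = 1}.ncard := by omega
  have h10 : (n : ℝ) + 8 ≤ 4 * ({v : V | (T.neighborSet v).ncard = 1}.ncard : ℝ) := by
    exact_mod_cast h9
  linarith
end

section
/- Let G = (V, E) be a finite connected undirected simple graph and let n ≥ 1 be an integer such that at least n vertices of G have degree > 2. Suppose in addition that a set of arrows (ordered pairs of distinct vertices) on V is given such that every vertex of G has positive in-degree with respect to these arrows. Then there is a subset V' ⊆ V such that the induced subgraph G|_{V'} is connected and the out-boundary ∂⃗V' = { w ∈ V ∖ V' : there is an arrow (v, w) with v ∈ V' } has at least n/12 + 2/3 elements. -/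
namespace Iolence

open Classical Finset

inductive Conn {V : Type*} (G : SimpleGraph V) : Finset V → Prop
  | single (r : V) : Conn G {r}
  | insert (D : Finset V) (a b : V) : Conn G D → a ∈ D → G.Adj a b → Conn G (insert b D)

theorem Conn.connected {V : Type*} {G : SimpleGraph V} {D : Finset V} (h : Conn G D) :
    (G.induce (D : Set V)).Connected := by
  induction h with
  | single r =>
    rw [Finset.coe_singleton]
    exact SimpleGraph.Connected.mk (SimpleGraph.Preconnected.of_subsingleton)
  | insert D a b _ ha hab ih =>
    have h2 : (G.induce ({a, b} : Set V)).Connected := SimpleGraph.induce_pair_connected_of_adj hab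
    have h3 := SimpleGraph.induce_union_connected ih.preconnected h2.preconnected
      ⟨a, by simpa using ha, by simp⟩
    have : ((Insert.insert b D : Finset V) : Set V) = (D : Set V) ∪ {a, b} := by
      ext x; simp; grind
    rw [this]; exact h3

theorem Conn.extend {V : Type*} {G : SimpleGraph V} {D : Finset V} (h : Conn G D)
    (S : Finset V) (hS : ∀ x ∈ S, ∃ a ∈ D, G.Adj a x) : Conn G (D ∪ S) := by
  induction S using Finset.induction_on with
  | empty => simpa using h
  | insert x S _ ih =>
    obtain ⟨a, ha, hax⟩ := hS x (by simp)
    have := Conn.insert _ a x (ih (fun y hy => hS y (by simp [hy]))) (by simp [ha]) hax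
    rwa [Finset.union_insert]

section
variable {V : Type*} [Fintype V] (G : SimpleGraph V)

noncomputable def nb (v : V) : Finset V := univ.filter (G.Adj v)
noncomputable def big : Finset V := univ.filter (fun v => 3 ≤ (nb G v).card)
noncomputable def out (D : Finset V) : Finset V := univ.filter (fun v => v ∉ D ∧ ∃ a ∈ D, G.Adj a v)
noncomputable def T (D : Finset V) : Finset V := D ∪ out G D
noncomputable def dead (D : Finset V) : Finset V := (out G D).filter (fun v => ∀ w, G.Adj v w → w ∈ T G D)
noncomputable def fresh (D : Finset V) (v : V) : Finset V := univ.filter (fun w => G.Adj v w ∧ w ∉ T G D)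
noncomputable def N (D : Finset V) : ℕ := (T G D ∩ big G).card

def P (D : Finset V) (c e : ℕ) : Prop :=
  N G D + c ≤ 3 * (out G D).card + (dead G D).card ∧
  (T G D = univ → N G D + c + e ≤ 3 * (out G D).card + (dead G D).card)

theorem mem_nb {v w : V} : w ∈ nb G v ↔ G.Adj v w := by simp [nb]
theorem mem_big {v : V} : v ∈ big G ↔ 3 ≤ (nb G v).card := by simp [big]
theorem mem_out {D : Finset V} {v : V} : v ∈ out G D ↔ v ∉ D ∧ ∃ a ∈ D, G.Adj a v := by simp [out]
theorem mem_T {D : Finset V} {v : V} : v ∈ T G D ↔ v ∈ D ∨ v ∈ out G D := by simp [T]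
theorem mem_dead {D : Finset V} {v : V} :
    v ∈ dead G D ↔ v ∈ out G D ∧ ∀ w, G.Adj v w → w ∈ T G D := by simp [dead]
theorem mem_fresh {D : Finset V} {v w : V} : w ∈ fresh G D v ↔ G.Adj v w ∧ w ∉ T G D := by
  simp [fresh]

theorem dead_of_univ {D : Finset V} (h : T G D = univ) : dead G D = out G D := by
  ext v; rw [mem_dead, h]; simp

theorem out_insert {D : Finset V} {v : V} (hv : v ∈ out G D) :
    out G (insert v D) = (out G D).erase v ∪ fresh G D v := by
  ext w
  have h1 := mem_out G (D := D) (v := v)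
  have h3 := G.ne_of_adj (a := v) (b := w)
  simp only [mem_out, mem_union, mem_erase, mem_fresh, mem_T, Finset.mem_insert]
  grind

theorem T_insert {D : Finset V} {v : V} (hv : v ∈ out G D) :
    T G (insert v D) = T G D ∪ fresh G D v := by
  ext w
  simp only [mem_T, out_insert G hv, mem_union, mem_erase, Finset.mem_insert]
  grind

theorem card_out_insert {D : Finset V} {v : V} (hv : v ∈ out G D) :
    (out G (insert v D)).card + 1 = (out G D).card + (fresh G D v).card := by
  rw [out_insert G hv, card_union_of_disjoint, ← card_erase_add_one hv]
  · ring
  · rw [Finset.disjoint_left]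
    intro a ha hb
    rw [mem_fresh, mem_T] at hb
    exact hb.2 (Or.inr (mem_of_mem_erase ha))

theorem N_insert {D : Finset V} {v : V} (hv : v ∈ out G D) :
    N G (insert v D) ≤ N G D + (fresh G D v ∩ big G).card := by
  unfold N
  rw [T_insert G hv, union_inter_distrib_right]
  exact card_union_le _ _

theorem N_insert' {D : Finset V} {v : V} (hv : v ∈ out G D) :
    N G (insert v D) ≤ N G D + (fresh G D v).card :=
  (N_insert G hv).trans (by gcongr; exact inter_subset_left)

theorem dead_insert {D : Finset V} {v : V} (hv : v ∈ out G D) (hf : (fresh G D v).Nonempty) :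
    dead G D ⊆ dead G (insert v D) := by
  intro x hx
  obtain ⟨w, hw⟩ := hf
  rw [mem_fresh] at hw
  rw [mem_dead] at hx ⊢
  rw [T_insert G hv, out_insert G hv]
  simp only [mem_union, mem_erase]
  grind

theorem conn_insert {D : Finset V} {v : V} (hD : Conn G D) (hv : v ∈ out G D) :
    Conn G (insert v D) := by
  rw [mem_out] at hv
  obtain ⟨_, a, ha, h⟩ := hv
  exact Conn.insert D a v hD ha h

theorem fresh_exists (hG : G.Connected) {D : Finset V} (hD : Conn G D) (hT : T G D ≠ univ) :
    ∃ v ∈ out G D, (fresh G D v).Nonempty := by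
  by_contra! hcon
  apply hT
  have hne : ∃ r, r ∈ T G D := by
    cases hD with
    | single r => exact ⟨r, by simp [mem_T]⟩
    | insert D a b => exact ⟨b, by simp [mem_T]⟩
  obtain ⟨r, hr⟩ := hne
  have hstep : ∀ a b, a ∈ T G D → G.Adj a b → b ∈ T G D := by
    intro a b ha hab
    by_contra hb
    rw [mem_T] at ha
    rcases ha with ha | ha
    · rw [mem_T, mem_out] at hb
      push Not at hb
      exact hb.2 hb.1 a ha hab
    · have := hcon a ha
      have h2 : b ∈ fresh G D a := by rw [mem_fresh]; exact ⟨hab, hb⟩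
      rw [this] at h2; simp at h2
  ext x
  simp only [mem_univ, iff_true]
  obtain ⟨p⟩ := hG.preconnected r x
  induction p with
  | nil => exact hr
  | cons h p ih => exact ih (hstep _ _ hr h)

theorem step (hG : G.Connected) {D : Finset V} (hD : Conn G D) (hT : T G D ≠ univ) {c e : ℕ}
    (he : e ≤ 1 ∨ (e ≤ 2 ∧ ∀ v, 2 ≤ (nb G v).card)) (hP : P G D c e) :
    ∃ D', Conn G D' ∧ D.card < D'.card ∧ P G D' c e := by
  obtain ⟨hP, -⟩ := hP
  by_cases h2 : ∃ v ∈ out G D, 2 ≤ (fresh G D v).card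
  · obtain ⟨v, hv, hc⟩ := h2
    have hne : (fresh G D v).Nonempty := card_pos.1 (by omega)
    have hd := dead_insert G hv hne
    have h1 := card_out_insert G hv
    have h3 := N_insert' G hv
    have h4 := card_le_card hd
    refine ⟨insert v D, conn_insert G hD hv, ?_, ?_, ?_⟩
    · rw [card_insert_of_notMem ((mem_out G).1 hv).1]; omega
    · omega
    · intro hu
      have h5 : (dead G D).card + (fresh G D v).card ≤ (dead G (insert v D)).card := by
        rw [← card_union_of_disjoint]
        · apply card_le_card
          apply union_subset hd
          rw [dead_of_univ G hu, out_insert G hv]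
          exact subset_union_right
        · rw [Finset.disjoint_left]
          intro a ha hb
          rw [mem_fresh, mem_T] at hb
          exact hb.2 (Or.inr ((mem_dead G).1 ha).1)
      omega
  push Not at h2
  obtain ⟨v, hv, hne⟩ := fresh_exists G hG hD hT
  have hA1 : (fresh G D v).card = 1 := by
    have := h2 v hv
    have := card_pos.2 hne
    omega
  obtain ⟨u, hu⟩ := card_eq_one.1 hA1
  have hvu : G.Adj v u ∧ u ∉ T G D := by rw [← mem_fresh, hu]; simp
  have hd := dead_insert G hv hne
  have h1 := card_out_insert G hv
  have h3 := N_insert G hv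
  have h3' := N_insert' G hv
  have h4 := card_le_card hd
  have hcD : (insert v D).card = D.card + 1 := card_insert_of_notMem ((mem_out G).1 hv).1
  have huo : u ∈ out G (insert v D) := by rw [out_insert G hv, hu]; simp
  by_cases hB : 2 ≤ (fresh G (insert v D) u).card
  · have hne' : (fresh G (insert v D) u).Nonempty := card_pos.1 (by omega)
    have hd' := dead_insert G huo hne'
    have k1 := card_out_insert G huo
    have k3 := N_insert' G huo
    have k4 := card_le_card hd'
    refine ⟨insert u (insert v D), conn_insert G (conn_insert G hD hv) huo, ?_, ?_, ?_⟩
    · rw [card_insert_of_notMem ((mem_out G).1 huo).1]; omega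
    · omega
    · intro hu
      have h5 : (dead G (insert v D)).card + (fresh G (insert v D) u).card ≤
          (dead G (insert u (insert v D))).card := by
        rw [← card_union_of_disjoint]
        · apply card_le_card
          apply union_subset hd'
          rw [dead_of_univ G hu, out_insert G huo]
          exact subset_union_right
        · rw [Finset.disjoint_left]
          intro a ha hb
          rw [mem_fresh, mem_T] at hb
          exact hb.2 (Or.inr ((mem_dead G).1 ha).1)
      omega
  -- the single expansion
  set C : Finset V := ((out G D).erase v).filter (fun w => G.Adj u w) with hC
  have hT' := T_insert G hv
  have ho' := out_insert G hv
  have huD : u ∉ D ∧ u ∉ out G D := by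
    have := hvu.2
    rw [mem_T] at this
    tauto
  have hCd : C ⊆ dead G (insert v D) := by
    intro w hw
    simp only [hC, mem_filter, mem_erase] at hw
    rw [mem_dead, ho', hT', hu]
    refine ⟨by simp [hw], ?_⟩
    intro x hx
    by_contra hxT
    simp only [mem_union, mem_singleton, not_or] at hxT
    have hh : 2 ≤ (fresh G D w).card := by
      have : ({x, u} : Finset V) ⊆ fresh G D w := by
        intro y hy
        simp only [Finset.mem_insert, mem_singleton] at hy
        rw [mem_fresh]
        rcases hy with rfl | rfl
        · exact ⟨hx, hxT.1⟩
        · exact ⟨hw.2.symm, hvu.2⟩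
      rw [← card_pair hxT.2]
      exact card_le_card this
    have := h2 w hw.1.2
    omega
  have hdis : Disjoint (dead G D) C := by
    rw [Finset.disjoint_left]
    intro a ha hb
    simp only [hC, mem_filter, mem_erase] at hb
    exact hvu.2 (((mem_dead G).1 ha).2 u hb.2.symm)
  have hM : (dead G D).card + C.card ≤ (dead G (insert v D)).card := by
    rw [← card_union_of_disjoint hdis]
    exact card_le_card (union_subset hd hCd)
  have hdeg : (nb G u).card ≤ 1 + (fresh G (insert v D) u).card + C.card := by
    have : nb G u ⊆ ({v} ∪ fresh G (insert v D) u) ∪ C := by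
      intro w hw
      rw [mem_nb] at hw
      have hwu := G.ne_of_adj hw
      have hwD : w ∉ D := fun h => huD.2 (by rw [mem_out]; exact ⟨huD.1, w, h, hw.symm⟩)
      simp only [mem_union, mem_singleton, mem_fresh, hT', hu, hC, mem_filter, mem_erase, mem_T]
      grind
    calc _ ≤ _ := card_le_card this
      _ ≤ _ := (card_union_le _ _).trans (by gcongr; exact (card_union_le _ _).trans (by simp))
  have hNu : (nb G u).card < 3 → N G (insert v D) ≤ N G D := by
    intro h
    have : fresh G D v ∩ big G = ∅ := by
      rw [hu]; ext x; simp only [mem_inter, mem_singleton, mem_big, notMem_empty, iff_false]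
      rintro ⟨rfl, h'⟩; omega
    rw [this] at h3; simpa using h3
  refine ⟨insert v D, conn_insert G hD hv, by omega, ?_, ?_⟩
  · by_cases h : (nb G u).card < 3
    · have := hNu h; omega
    · omega
  · intro hun
    have hB0 : (fresh G (insert v D) u).card = 0 := by
      rw [card_eq_zero]; ext x; simp [mem_fresh, hun]
    have hM' : (dead G D).card + C.card + 1 ≤ (dead G (insert v D)).card := by
      rw [← card_union_of_disjoint hdis, ← card_insert_of_notMem (a := u)]
      · apply card_le_card
        apply insert_subset
        · rwa [dead_of_univ G hun]
        · exact union_subset hd hCd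
      · simp only [mem_union, hC, mem_filter, mem_erase, mem_dead]; grind
    by_cases h : (nb G u).card < 3
    · have := hNu h
      rcases he with he | ⟨he, hmin⟩
      · omega
      · have := hmin u; omega
    · omega

theorem grow (hG : G.Connected) {c e : ℕ}
    (he : e ≤ 1 ∨ (e ≤ 2 ∧ ∀ v, 2 ≤ (nb G v).card)) :
    ∀ (k : ℕ) (D : Finset V), Fintype.card V - D.card ≤ k → Conn G D → P G D c e →
      ∃ D', Conn G D' ∧ T G D' = univ ∧ P G D' c e := by
  intro k
  induction k with
  | zero =>
    intro D hk hD hP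
    refine ⟨D, hD, ?_, hP⟩
    have : D = univ := by
      rw [← card_eq_iff_eq_univ]
      have := card_le_univ D
      omega
    ext x; simp [mem_T, this]
  | succ k ih =>
    intro D hk hD hP
    by_cases hT : T G D = univ
    · exact ⟨D, hD, hT, hP⟩
    · obtain ⟨D', h1, h2, h3⟩ := step G hG hD hT he hP
      exact ih D' (by omega) h1 h3

theorem finish (hG : G.Connected) {c e : ℕ}
    (he : e ≤ 1 ∨ (e ≤ 2 ∧ ∀ v, 2 ≤ (nb G v).card)) (hce : c + e = 8)
    {D : Finset V} (hD : Conn G D) (hP : P G D c e) :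
    ∃ D', Conn G D' ∧ T G D' = univ ∧ (big G).card + 8 ≤ 4 * (out G D').card := by
  obtain ⟨D', h1, h2, h3⟩ := grow G hG he _ D le_rfl hD hP
  refine ⟨D', h1, h2, ?_⟩
  have := h3.2 h2
  rw [dead_of_univ G h2] at this
  unfold N at this
  rw [h2, univ_inter] at this
  omega

theorem out_single (r : V) : out G {r} = nb G r := by
  ext v
  have := G.ne_of_adj (a := r) (b := v)
  simp only [mem_out, mem_nb, mem_singleton]
  grind

theorem T_single (r : V) : T G {r} = insert r (nb G r) := by
  rw [T, out_single]; rfl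

theorem card_T_single (r : V) : (T G {r}).card = (nb G r).card + 1 := by
  rw [T_single, card_insert_of_notMem]
  simp [mem_nb]

theorem main (hG : G.Connected) (hn : (big G).Nonempty) :
    ∃ D, Conn G D ∧ T G D = univ ∧ (big G).card + 8 ≤ 4 * (out G D).card := by
  by_cases h4 : ∃ r, 4 ≤ (nb G r).card
  · obtain ⟨r, hr⟩ := h4
    have hN : N G {r} ≤ (nb G r).card + 1 := by
      rw [← card_T_single]; exact card_le_card inter_subset_left
    refine finish G hG (c := 7) (e := 1) (Or.inl le_rfl) rfl (Conn.single r) ⟨?_, ?_⟩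
    · rw [out_single]; omega
    · intro hu; rw [dead_of_univ G hu, out_single]; omega
  push Not at h4
  obtain ⟨r, hr⟩ := hn
  rw [mem_big] at hr
  by_cases h1 : ∃ x, (nb G x).card < 2
  · obtain ⟨x, hx⟩ := h1
    -- x has exactly one neighbour
    have hxr : x ≠ r := by rintro rfl; omega
    have hex : ∃ y, G.Adj x y := by
      obtain ⟨p⟩ := hG.preconnected x r
      cases p with
      | nil => exact absurd rfl hxr
      | cons h p => exact ⟨_, h⟩
    obtain ⟨y, hxy⟩ := hex
    have hxnb : nb G x = {y} := by
      have hy : y ∈ nb G x := (mem_nb G).2 hxy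
      have : (nb G x).card = 1 := by
        have := card_pos.2 ⟨y, hy⟩; omega
      obtain ⟨z, hz⟩ := card_eq_one.1 this
      rw [hz] at hy ⊢
      rw [mem_singleton.1 hy]
    have hx' : ∀ w, G.Adj x w → w = y := by
      intro w hw
      rw [← mem_nb, hxnb, mem_singleton] at hw
      exact hw
    have hxb : x ∉ big G := by rw [mem_big]; omega
    have hxy' := G.ne_of_adj hxy
    have hxdead : ∀ D : Finset V, y ∈ D → x ∉ D → x ∈ dead G D := by
      intro D hy hx
      rw [mem_dead, mem_out]
      refine ⟨⟨hx, y, hy, hxy.symm⟩, ?_⟩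
      intro w hw
      rw [hx' w hw, mem_T]; exact Or.inl hy
    have hx1 : 1 ≤ (dead G {y}).card := card_pos.2 ⟨x, hxdead {y} (by simp) (by simpa using hxy')⟩
    have hxT : x ∈ T G {y} := by
      rw [T_single]; simp [mem_nb, hxy.symm]
    by_cases hy3 : 3 ≤ (nb G y).card
    · have hN : N G {y} ≤ (nb G y).card := by
        have : T G {y} ∩ big G ⊆ (T G {y}).erase x := by
          intro w hw
          rw [mem_inter] at hw
          rw [mem_erase]
          exact ⟨by rintro rfl; exact hxb hw.2, hw.1⟩
        have := card_le_card this
        rw [card_erase_of_mem hxT, card_T_single] at this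
        exact this
      refine finish G hG (c := 7) (e := 1) (Or.inl le_rfl) rfl (Conn.single y) ⟨?_, ?_⟩
      · rw [out_single]; omega
      · intro hu; rw [dead_of_univ G hu, out_single]; omega
    have hyb : y ∉ big G := by rw [mem_big]; exact hy3
    have hry : r ≠ y := by rintro rfl; exact hy3 hr
    have hTn : T G {y} ≠ univ → ∃ v ∈ out G {y}, (fresh G {y} v).Nonempty :=
      fresh_exists G hG (Conn.single y)
    -- the second neighbour of y
    have hz : ∃ z, z ≠ x ∧ G.Adj y z := by
      by_contra! hcon
      have hT : T G {y} = univ := by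
        by_contra hT
        obtain ⟨v, hv, w, hw⟩ := hTn hT
        rw [out_single, mem_nb] at hv
        have hvx : v = x := by by_contra h; exact hcon v h hv
        subst hvx
        rw [mem_fresh] at hw
        have := hx' w hw.1
        subst this
        exact hw.2 (by simp [mem_T])
      have : r ∈ T G {y} := by rw [hT]; simp
      rw [T_single, Finset.mem_insert, mem_nb] at this
      rcases this with h | h
      · exact hry h
      · exact hcon r hxr.symm h
    obtain ⟨z, hzx, hyz⟩ := hz
    have hynb : nb G y = {x, z} := by
      symm
      apply eq_of_subset_of_card_le
      · intro w hw
        simp only [Finset.mem_insert, mem_singleton] at hw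
        rw [mem_nb]
        rcases hw with rfl | rfl
        · exact hxy.symm
        · exact hyz
      · rw [card_pair hzx.symm]; omega
    have hycard : (nb G y).card = 2 := by rw [hynb, card_pair hzx.symm]
    have hzy := G.ne_of_adj hyz
    by_cases hz3 : 3 ≤ (nb G z).card
    · have hzo : z ∈ out G {y} := by rw [out_single, mem_nb]; exact hyz
      have hfc : (fresh G {y} z).card + 1 = (nb G z).card := by
        have : fresh G {y} z = (nb G z).erase y := by
          ext w
          have hzw := G.ne_of_adj (a := z) (b := w)
          have hzx' : ¬ G.Adj z x := fun h => hzy (hx' z h.symm).symm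
          rw [mem_fresh, mem_erase, mem_nb, T_single, hynb]
          simp only [Finset.mem_insert, mem_singleton]
          grind
        rw [this, card_erase_add_one]
        rw [mem_nb]; exact hyz.symm
      have hNy : N G {y} ≤ 1 := by
        have : T G {y} ∩ big G ⊆ {z} := by
          intro w hw
          rw [mem_inter, T_single, hynb] at hw
          simp only [Finset.mem_insert, mem_singleton] at hw ⊢
          grind
        exact (card_le_card this).trans (by simp)
      have k1 := card_out_insert G hzo
      have k3 := N_insert' G hzo
      have k4 : 1 ≤ (dead G (insert z {y})).card :=
        card_pos.2 ⟨x, hxdead _ (by simp) (by simp [hxy', hzx.symm])⟩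
      rw [out_single] at k1
      refine finish G hG (c := 7) (e := 1) (Or.inl le_rfl) rfl
        (conn_insert G (Conn.single y) hzo) ⟨?_, ?_⟩
      · omega
      · intro hu; rw [dead_of_univ G hu]; omega
    · have hzb : z ∉ big G := by rw [mem_big]; exact hz3
      have hNy : N G {y} = 0 := by
        unfold N
        rw [card_eq_zero]
        ext w
        rw [mem_inter, T_single, hynb]
        simp only [Finset.mem_insert, mem_singleton, notMem_empty]
        grind
      refine finish G hG (c := 7) (e := 1) (Or.inl le_rfl) rfl (Conn.single y) ⟨?_, ?_⟩
      · rw [out_single]; omega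
      · intro hu; rw [dead_of_univ G hu, out_single]; omega
  push Not at h1
  have hr3 : (nb G r).card = 3 := by have := h4 r; omega
  have hN : N G {r} ≤ 4 := by
    have := card_T_single G r
    rw [hr3] at this
    have h2 : N G {r} ≤ (T G {r}).card := card_le_card inter_subset_left
    omega
  have he : (2 : ℕ) ≤ 1 ∨ ((2 : ℕ) ≤ 2 ∧ ∀ v, 2 ≤ (nb G v).card) := Or.inr ⟨le_rfl, h1⟩
  by_cases hgood : N G {r} ≤ 3 ∨ 1 ≤ (dead G {r}).card
  · refine finish G hG (c := 6) (e := 2) he rfl (Conn.single r) ⟨?_, ?_⟩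
    · rw [out_single]; omega
    · intro hu; rw [dead_of_univ G hu, out_single]; omega
  push Not at hgood
  by_cases h2 : ∃ v ∈ out G {r}, 2 ≤ (fresh G {r} v).card
  · obtain ⟨v, hv, hf⟩ := h2
    have k1 := card_out_insert G hv
    have k3 := N_insert' G hv
    rw [out_single] at k1
    refine finish G hG (c := 6) (e := 2) he rfl (conn_insert G (Conn.single r) hv) ⟨?_, ?_⟩
    · omega
    · intro hu; rw [dead_of_univ G hu]; omega
  push Not at h2
  exfalso
  have hTb : T G {r} ⊆ big G := by
    have h : T G {r} ∩ big G = T G {r} := by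
      apply eq_of_subset_of_card_le inter_subset_left
      have := card_T_single G r
      have h3 : (T G {r} ∩ big G).card = N G {r} := rfl
      omega
    rw [← h]; exact inter_subset_right
  have hd0 : dead G {r} = ∅ := by rw [← card_eq_zero]; omega
  obtain ⟨a, b, c, hab, hac, hbc, habc⟩ := card_eq_three.1 hr3
  have hTabc : T G {r} = {r, a, b, c} := by rw [T_single, habc]
  -- each of a, b, c has exactly one neighbour outside and two inside
  have key : ∀ v ∈ nb G r, ((nb G v) ∩ T G {r}).card = 2 := by
    intro v hv
    have hvo : v ∈ out G {r} := by rw [out_single]; exact hv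
    have hf1 : 1 ≤ (fresh G {r} v).card := by
      rw [Nat.one_le_iff_ne_zero, Ne, card_eq_zero]
      intro h0
      have : v ∈ dead G {r} := by
        rw [mem_dead]
        refine ⟨hvo, fun w hw => ?_⟩
        by_contra hwT
        have : w ∈ fresh G {r} v := by rw [mem_fresh]; exact ⟨hw, hwT⟩
        rw [h0] at this; simp at this
      rw [hd0] at this; simp at this
    have hf2 := h2 v hvo
    have hv3 : 3 ≤ (nb G v).card := by
      rw [← mem_big]; apply hTb; rw [mem_T]; exact Or.inr hvo
    have hv4 := h4 v
    have hs : (nb G v) \ T G {r} = fresh G {r} v := by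
      ext w; simp [mem_nb, mem_fresh]
    have := card_inter_add_card_sdiff (nb G v) (T G {r})
    rw [hs] at this
    omega
  have hA : ∀ v ∈ nb G r, ((nb G v) ∩ nb G r).card = 1 := by
    intro v hv
    have h3 := key v hv
    have : (nb G v) ∩ T G {r} = insert r ((nb G v) ∩ nb G r) := by
      ext w
      rw [mem_nb] at hv
      have := hv.symm
      simp only [mem_inter, T_single, Finset.mem_insert, mem_nb]
      grind
    rw [this, card_insert_of_notMem (by simp [mem_nb])] at h3
    omega
  rw [habc] at hA
  have hAa := hA a (by simp)
  have hAb := hA b (by simp)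
  have hAc := hA c (by simp)
  have hsum : ∀ v, (nb G v ∩ {a, b, c}).card =
      (if G.Adj v a then 1 else 0) + (if G.Adj v b then 1 else 0) + (if G.Adj v c then 1 else 0) := by
    intro v
    have : nb G v ∩ {a, b, c} = ({a, b, c} : Finset V).filter (G.Adj v) := by
      ext w; simp [mem_nb, and_comm]
    rw [this, card_filter, sum_insert (by simp [hab, hac]), sum_pair hbc]
    ring
  rw [hsum] at hAa hAb hAc
  rw [G.adj_comm b a] at hAb
  rw [G.adj_comm c a, G.adj_comm c b] at hAc
  simp only [SimpleGraph.irrefl, if_false] at hAa hAb hAc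
  split_ifs at hAa hAb hAc <;> omega

end

theorem three_color {V : Type*} (f : V → V) (hf : ∀ v, f v ≠ v) (S : Finset V) :
    ∃ g : V → Fin 3, ∀ w ∈ S, f w ∈ S → g w ≠ g (f w) := by
  induction hk : S.card generalizing S with
  | zero =>
    rw [card_eq_zero] at hk
    subst hk
    exact ⟨fun _ => 0, by simp⟩
  | succ k ih =>
    have hx : ∃ x ∈ S, (S.filter (fun w => f w = x)).card ≤ 1 := by
      by_contra! hcon
      have h1 : ∑ x ∈ S, (S.filter (fun w => f w = x)).card ≤ S.card := by
        rw [← card_biUnion]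
        · apply card_le_card
          intro y hy
          simp only [mem_biUnion, mem_filter] at hy
          grind
        · intro a _ b _ hab
          simp only [Finset.disjoint_left, mem_filter]
          grind
      have h2 : ∑ x ∈ S, 2 ≤ ∑ x ∈ S, (S.filter (fun w => f w = x)).card :=
        sum_le_sum (fun x hx => hcon x hx)
      simp at h2
      omega
    obtain ⟨x, hxS, hx⟩ := hx
    obtain ⟨g, hg⟩ := ih (S.erase x) (by rw [card_erase_of_mem hxS]; omega)
    have hq : ∃ q : V, ∀ w ∈ S, f w = x → w = q := by
      rw [card_le_one_iff] at hx
      by_cases h : ∃ q ∈ S, f q = x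
      · obtain ⟨q, hq, hq'⟩ := h
        exact ⟨q, fun w hw hwx => hx (by simp [hw, hwx]) (by simp [hq, hq'])⟩
      · exact ⟨x, fun w hw hwx => absurd ⟨w, hw, hwx⟩ h⟩
    obtain ⟨q, hq⟩ := hq
    have hc : ∀ i j : Fin 3, ∃ l : Fin 3, l ≠ i ∧ l ≠ j := by decide
    obtain ⟨l, hl1, hl2⟩ := hc (g (f x)) (g q)
    refine ⟨Function.update g x l, ?_⟩
    intro w hw hfw
    by_cases hwx : w = x
    · subst hwx
      rw [Function.update_self, Function.update_of_ne (hf w)]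
      exact hl1
    · rw [Function.update_of_ne hwx]
      by_cases hfx : f w = x
      · rw [hfx, Function.update_self, hq w hw hfx]
        exact hl2.symm
      · rw [Function.update_of_ne hfx]
        exact hg w (by simp [hwx, hw]) (by simp [hfx, hfw])

end Iolence

open Iolence in
theorem prop_iolence (V : Type*) [Fintype V] (G : SimpleGraph V) (R : V → V → Prop) (n : ℕ)
    (hG : G.Connected) (hn : 1 ≤ n)
    (hdeg : n ≤ {v : V | 2 < (G.neighborSet v).ncard}.ncard)
    (hirr : ∀ v : V, ¬R v v) (hin : ∀ w : V, ∃ v : V, R v w) :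
    ∃ V' : Set V, (G.induce V').Connected ∧
      (n : ℝ) / 12 + 2 / 3 ≤ ({w : V | w ∉ V' ∧ ∃ v ∈ V', R v w}.ncard : ℝ) := by
  classical
  have hnb : ∀ v, (G.neighborSet v).ncard = (nb G v).card := by
    intro v
    rw [← Set.ncard_coe_finset]
    congr 1
    ext w; simp [mem_nb]
  have hbig : {v : V | 2 < (G.neighborSet v).ncard} = (big G : Set V) := by
    ext v
    rw [Finset.mem_coe, mem_big, Set.mem_ofPred_eq, hnb]
    omega
  rw [hbig, Set.ncard_coe_finset] at hdeg
  obtain ⟨D, hD, hT, hL⟩ := Iolence.main G hG (Finset.card_pos.1 (by omega))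
  choose f hf using hin
  obtain ⟨g, hg⟩ := three_color f (fun v h => hirr v (by have := hf v; rwa [h] at this)) (out G D)
  have hi : ∃ i : Fin 3, (out G D).card ≤ 3 * ((out G D).filter (fun w => g w = i)).card := by
    by_contra! hcon
    have h := Finset.card_eq_sum_card_fiberwise (s := out G D) (t := Finset.univ) (f := g)
      (by intro x _; simp)
    rw [Fin.sum_univ_three] at h
    have h0 := hcon 0
    have h1 := hcon 1
    have h2 := hcon 2
    omega
  obtain ⟨i, hi⟩ := hi
  set L' := (out G D).filter (fun w => g w = i) with hL'
  refine ⟨((D ∪ (out G D \ L') : Finset V) : Set V), ?_, ?_⟩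
  · apply Conn.connected
    apply hD.extend
    intro x hx
    rw [Finset.mem_sdiff, mem_out] at hx
    exact hx.1.2
  · have hsub : (L' : Set V) ⊆ {w : V | w ∉ ((D ∪ (out G D \ L') : Finset V) : Set V) ∧
        ∃ v ∈ ((D ∪ (out G D \ L') : Finset V) : Set V), R v w} := by
      intro w hw
      rw [Finset.mem_coe] at hw
      have hw' := hw
      rw [hL', Finset.mem_filter] at hw'
      have hwD := ((mem_out G).1 hw'.1).1
      refine ⟨by simp [hwD, hw], f w, ?_, hf w⟩
      have hfT : f w ∈ T G D := by rw [hT]; simp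
      rw [mem_T] at hfT
      rw [Finset.mem_coe, Finset.mem_union, Finset.mem_sdiff]
      rcases hfT with h | h
      · exact Or.inl h
      · refine Or.inr ⟨h, fun h' => ?_⟩
        rw [hL', Finset.mem_filter] at h'
        exact hg w hw'.1 h (hw'.2.trans h'.2.symm)
    have hcard := Set.ncard_le_ncard hsub (Set.toFinite _)
    rw [Set.ncard_coe_finset] at hcard
    have h12 : n + 8 ≤ 12 * {w : V | w ∉ ((D ∪ (out G D \ L') : Finset V) : Set V) ∧
        ∃ v ∈ ((D ∪ (out G D \ L') : Finset V) : Set V), R v w}.ncard := by omega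
    have : ((n : ℝ) + 8) ≤ 12 * ({w : V | w ∉ ((D ∪ (out G D \ L') : Finset V) : Set V) ∧
        ∃ v ∈ ((D ∪ (out G D \ L') : Finset V) : Set V), R v w}.ncard : ℝ) := by exact_mod_cast h12
    linarith
end
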